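/- Separability guarantee of average-link: for every k with 2 ≤ k ≤ n and every execution of average-link on a finite metric space with n points, the k-clustering A^k satisfies sep_av(A^k) ≥ OPT_SEP(k) / (k + 2·H_n). -/

import Mathlib

open Finset

/-- Average distance between two finite sets of points. -/
noncomputable def avgD {X : Type*} (d : X → X → ℝ) (A B : Finset X) : ℝ :=
  (∑ a ∈ A, ∑ b ∈ B, d a b) / ((A.card : ℝ) * (B.card : ℝ))

/-- A `k`-clustering of `X`: a partition of all points of `X` into `k` nonempty clusters. -/
def IsClustering {X : Type*} (𝒞 : Finset (Finset X)) (k : ℕ) : Prop :=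
  𝒞.card = k ∧ (∀ C ∈ 𝒞, C.Nonempty) ∧
    (∀ C ∈ 𝒞, ∀ C' ∈ 𝒞, C ≠ C' → Disjoint C C') ∧ (∀ x : X, ∃ C ∈ 𝒞, x ∈ C)

/-- `sep_av(𝒞) = (1/C(k,2)) · Σ_{i<j} avg(Cᵢ,Cⱼ)`. -/
noncomputable def sepAv {X : Type*} [DecidableEq X] (d : X → X → ℝ)
    (𝒞 : Finset (Finset X)) : ℝ :=
  (∑ C ∈ 𝒞, ∑ C' ∈ 𝒞, if C ≠ C' then avgD d C C' else 0) / (2 * (𝒞.card.choose 2 : ℝ))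

/-- The `p`-th harmonic number `H_p = Σ_{i=1}^p 1/i`. -/
noncomputable def harmonicR (p : ℕ) : ℝ := ∑ i ∈ Finset.range p, (1 : ℝ) / (i + 1)

/-- An execution of average-link. -/
structure AvgLinkExec (X : Type*) [Fintype X] [DecidableEq X] (d : X → X → ℝ) where
  part : ℕ → Finset (Finset X)
  init : part (Fintype.card X) = Finset.univ.image (fun x : X => ({x} : Finset X))
  merge : ∀ k : ℕ, 1 ≤ k → k < Fintype.card X →
    ∃ A ∈ part (k + 1), ∃ B ∈ part (k + 1), A ≠ B ∧
      (∀ A' ∈ part (k + 1), ∀ B' ∈ part (k + 1), A' ≠ B' → avgD d A B ≤ avgD d A' B') ∧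
      part k = insert (A ∪ B) (((part (k + 1)).erase A).erase B)

theorem harmonicR_nonneg (p : ℕ) : 0 ≤ harmonicR p :=
  Finset.sum_nonneg fun _ _ => by positivity

theorem harmonicR_mono {p q : ℕ} (h : p ≤ q) : harmonicR p ≤ harmonicR q :=
  Finset.sum_le_sum_of_subset_of_nonneg (Finset.range_mono h) fun _ _ _ => by positivity

/-- The harmonic sum grows by at least `t / (s + t)` between `s` and `s + t`. -/
theorem add_mul_harmonicR_add_le (s t : ℕ) :
    ((s : ℝ) + t) * harmonicR s + t ≤ ((s : ℝ) + t) * harmonicR (s + t) := by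
  rcases Nat.eq_zero_or_pos t with rfl | ht
  · simp
  have hst : (0 : ℝ) < (s : ℝ) + t := by positivity
  have h : (t : ℝ) * (1 / ((s : ℝ) + t)) ≤
      ∑ i ∈ range t, (1 : ℝ) / (((s + i : ℕ) : ℝ) + 1) := by
    have := Finset.card_nsmul_le_sum (range t)
      (fun i => (1 : ℝ) / (((s + i : ℕ) : ℝ) + 1)) (1 / ((s : ℝ) + t)) (by
        intro i hi
        have hi' : ((i : ℝ) + 1) ≤ t := by exact_mod_cast Finset.mem_range.1 hi
        apply one_div_le_one_div_of_le
        · positivity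
        · push_cast; linarith)
    simpa using this
  have e : harmonicR (s + t) =
      harmonicR s + ∑ i ∈ range t, (1 : ℝ) / (((s + i : ℕ) : ℝ) + 1) := by
    unfold harmonicR
    rw [Finset.sum_range_add]
  rw [e, mul_add]
  have h2 := mul_le_mul_of_nonneg_left h hst.le
  have e2 : ((s : ℝ) + t) * ((t : ℝ) * (1 / ((s : ℝ) + t))) = t := by field_simp
  linarith

theorem card_pos_real {X : Type*} {A : Finset X} (hA : A.Nonempty) : (0 : ℝ) < A.card := by
  exact_mod_cast hA.card_pos

theorem sum_sum_ite_ne_const {X : Type*} [DecidableEq X] (𝒞 : Finset (Finset X)) (m : ℝ) :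
    (∑ C ∈ 𝒞, ∑ C' ∈ 𝒞, if C ≠ C' then m else 0) = m * ((𝒞.card : ℝ) * (𝒞.card - 1)) := by
  have : ∀ C ∈ 𝒞, (∑ C' ∈ 𝒞, if C ≠ C' then m else 0) = ((𝒞.card : ℝ) - 1) * m := by
    intro C hC
    have : ∀ C' ∈ 𝒞, (if C ≠ C' then m else 0) = m - if C = C' then m else 0 := by
      intro C' _
      split_ifs <;> simp_all
    rw [Finset.sum_congr rfl this, Finset.sum_sub_distrib, Finset.sum_ite_eq]
    simp [hC]; ring
  rw [Finset.sum_congr rfl this]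
  simp; ring

section Metric

variable {X : Type*} [MetricSpace X]

theorem le_avgD_iff {A B : Finset X} (hA : A.Nonempty) (hB : B.Nonempty) (m : ℝ) :
    m ≤ avgD dist A B ↔ m * ((A.card : ℝ) * B.card) ≤ ∑ a ∈ A, ∑ b ∈ B, dist a b :=
  le_div_iff₀ (mul_pos (card_pos_real hA) (card_pos_real hB))

theorem avgD_mul_card {A B : Finset X} (hA : A.Nonempty) (hB : B.Nonempty) :
    avgD dist A B * ((A.card : ℝ) * B.card) = ∑ a ∈ A, ∑ b ∈ B, dist a b :=
  div_mul_cancel₀ _ (mul_pos (card_pos_real hA) (card_pos_real hB)).ne'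

theorem avgD_nonneg (A B : Finset X) : 0 ≤ avgD dist A B :=
  div_nonneg (Finset.sum_nonneg fun _ _ => Finset.sum_nonneg fun _ _ => dist_nonneg)
    (by positivity)

theorem avgD_comm (A B : Finset X) : avgD dist A B = avgD dist B A := by
  unfold avgD
  rw [Finset.sum_comm, mul_comm (A.card : ℝ)]
  simp only [dist_comm]

theorem avgD_le_of_dist_le {A B : Finset X} {D : ℝ} (hD : 0 ≤ D)
    (h : ∀ a b : X, dist a b ≤ D) : avgD dist A B ≤ D := by
  refine div_le_of_le_mul₀ (by positivity) hD ?_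
  calc ∑ a ∈ A, ∑ b ∈ B, dist a b ≤ ∑ _a ∈ A, ∑ _b ∈ B, D :=
        Finset.sum_le_sum fun a _ => Finset.sum_le_sum fun b _ => h a b
    _ = D * ((A.card : ℝ) * B.card) := by simp; ring

/-- Triangle inequality for a point and two sets, in sum form. -/
theorem card_mul_sum_dist_le (p : X) (S T : Finset X) :
    (S.card : ℝ) * ∑ t ∈ T, dist p t ≤
      T.card * ∑ s ∈ S, dist p s + ∑ s ∈ S, ∑ t ∈ T, dist s t := by
  calc (S.card : ℝ) * ∑ t ∈ T, dist p t = ∑ _s ∈ S, ∑ t ∈ T, dist p t := by simp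
    _ ≤ ∑ s ∈ S, ∑ t ∈ T, (dist p s + dist s t) :=
        Finset.sum_le_sum fun s _ => Finset.sum_le_sum fun t _ => dist_triangle _ _ _
    _ = _ := by simp [Finset.sum_add_distrib, Finset.mul_sum]

theorem card_mul_dist_le (p q : X) (A : Finset X) :
    (A.card : ℝ) * dist p q ≤ ∑ a ∈ A, dist p a + ∑ a ∈ A, dist q a := by
  calc (A.card : ℝ) * dist p q = ∑ _a ∈ A, dist p q := by simp
    _ ≤ ∑ a ∈ A, (dist p a + dist q a) :=
        Finset.sum_le_sum fun a _ => dist_triangle_right _ _ _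
    _ = _ := Finset.sum_add_distrib

theorem avgD_triangle {A B C : Finset X} (hA : A.Nonempty) (hB : B.Nonempty)
    (hC : C.Nonempty) : avgD dist A C ≤ avgD dist A B + avgD dist B C := by
  have h : (B.card : ℝ) * ∑ a ∈ A, ∑ c ∈ C, dist a c ≤
      C.card * ∑ a ∈ A, ∑ b ∈ B, dist a b + A.card * ∑ b ∈ B, ∑ c ∈ C, dist b c := by
    have := Finset.sum_le_sum fun a (_ : a ∈ A) => card_mul_sum_dist_le a B C
    simpa [Finset.sum_add_distrib, ← Finset.mul_sum] using this
  rw [← avgD_mul_card hA hC, ← avgD_mul_card hA hB, ← avgD_mul_card hB hC] at h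
  have hpos : (0 : ℝ) < A.card * B.card * C.card :=
    mul_pos (mul_pos (card_pos_real hA) (card_pos_real hB)) (card_pos_real hC)
  refine le_of_mul_le_mul_right ?_ hpos
  linarith

variable [DecidableEq X]

theorem sum_sum_avgD_eq (𝒞 : Finset (Finset X)) (h : 2 ≤ 𝒞.card) :
    (∑ C ∈ 𝒞, ∑ C' ∈ 𝒞, if C ≠ C' then avgD dist C C' else 0) =
      sepAv dist 𝒞 * ((𝒞.card : ℝ) * (𝒞.card - 1)) := by
  have e : 2 * ((𝒞.card.choose 2 : ℕ) : ℝ) = (𝒞.card : ℝ) * (𝒞.card - 1) := by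
    rw [Nat.cast_choose_two]; ring
  have h2 : (2 : ℝ) ≤ 𝒞.card := by exact_mod_cast h
  rw [sepAv, e, div_mul_cancel₀]
  have : (0 : ℝ) < (𝒞.card : ℝ) * (𝒞.card - 1) := mul_pos (by linarith) (by linarith)
  exact this.ne'

theorem le_sepAv {𝒞 : Finset (Finset X)} (h : 2 ≤ 𝒞.card) {m : ℝ}
    (hm : ∀ C ∈ 𝒞, ∀ C' ∈ 𝒞, C ≠ C' → m ≤ avgD dist C C') : m ≤ sepAv dist 𝒞 := by
  have h2 : (2 : ℝ) ≤ 𝒞.card := by exact_mod_cast h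
  have hpos : (0 : ℝ) < (𝒞.card : ℝ) * (𝒞.card - 1) := mul_pos (by linarith) (by linarith)
  refine le_of_mul_le_mul_right ?_ hpos
  rw [← sum_sum_avgD_eq 𝒞 h, ← sum_sum_ite_ne_const]
  refine Finset.sum_le_sum fun C hC => Finset.sum_le_sum fun C' hC' => ?_
  split_ifs with hne
  exacts [hm C hC C' hC' hne, le_rfl]

theorem sepAv_le {𝒞 : Finset (Finset X)} (h : 2 ≤ 𝒞.card) {m : ℝ}
    (hm : ∀ C ∈ 𝒞, ∀ C' ∈ 𝒞, C ≠ C' → avgD dist C C' ≤ m) : sepAv dist 𝒞 ≤ m := by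
  have h2 : (2 : ℝ) ≤ 𝒞.card := by exact_mod_cast h
  have hpos : (0 : ℝ) < (𝒞.card : ℝ) * (𝒞.card - 1) := mul_pos (by linarith) (by linarith)
  refine le_of_mul_le_mul_right ?_ hpos
  rw [← sum_sum_avgD_eq 𝒞 h, ← sum_sum_ite_ne_const]
  refine Finset.sum_le_sum fun C hC => Finset.sum_le_sum fun C' hC' => ?_
  split_ifs with hne
  exacts [hm C hC C' hC' hne, le_rfl]

/-- By the triangle inequality, the rows of two clusters bound their average distance. -/
theorem avgD_le_mul_sepAv {𝒞 : Finset (Finset X)} (h : 2 ≤ 𝒞.card)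
    (hne : ∀ C ∈ 𝒞, C.Nonempty) {A B : Finset X} (hA : A ∈ 𝒞) (hB : B ∈ 𝒞) (hAB : A ≠ B) :
    avgD dist A B ≤ ((𝒞.card : ℝ) - 1) * sepAv dist 𝒞 := by
  have h2 : (2 : ℝ) ≤ 𝒞.card := by exact_mod_cast h
  set f : Finset X → Finset X → ℝ := fun C C' => if C ≠ C' then avgD dist C C' else 0 with hf
  have hf0 : ∀ C C', 0 ≤ f C C' := by
    intro C C'
    simp only [hf]
    split_ifs
    exacts [avgD_nonneg _ _, le_rfl]
  have hrows : ∑ C ∈ {A, B}, ∑ C' ∈ 𝒞, f C C' ≤ ∑ C ∈ 𝒞, ∑ C' ∈ 𝒞, f C C' := by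
    apply Finset.sum_le_sum_of_subset_of_nonneg
    · intro C hC
      simp only [Finset.mem_insert, Finset.mem_singleton] at hC
      rcases hC with rfl | rfl <;> assumption
    · exact fun C _ _ => Finset.sum_nonneg fun C' _ => hf0 C C'
  rw [Finset.sum_pair hAB, ← Finset.sum_add_distrib] at hrows
  have hcol : (𝒞.card : ℝ) * avgD dist A B ≤ ∑ C ∈ 𝒞, (f A C + f B C) := by
    rw [← nsmul_eq_mul]
    apply Finset.card_nsmul_le_sum
    intro C hC
    by_cases h1 : A = C
    · subst h1
      simp [hf, hAB.symm, avgD_comm A B]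
    by_cases h2 : B = C
    · subst h2
      simp [hf, hAB]
    · simp only [hf, ne_eq, h1, h2, not_false_eq_true, if_true]
      rw [avgD_comm B C]
      exact avgD_triangle (hne A hA) (hne C hC) (hne B hB)
  have hS := sum_sum_avgD_eq 𝒞 h
  have : (𝒞.card : ℝ) * avgD dist A B ≤
      (𝒞.card : ℝ) * (((𝒞.card : ℝ) - 1) * sepAv dist 𝒞) := by
    calc _ ≤ _ := hcol.trans hrows
      _ = _ := hS
      _ = _ := by ring
  exact le_of_mul_le_mul_left this (by linarith)

/-- Merging two clusters keeps the average distance from a point of the first one below a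
harmonic multiple of the merging level. -/
theorem sum_dist_union_le {S T : Finset X} (hS : S.Nonempty) (hT : T.Nonempty)
    (hd : Disjoint S T) {m : ℝ} (hm : m ≤ avgD dist S T) {p : X}
    (hp : ∑ x ∈ S, dist p x ≤ S.card * (m * harmonicR S.card)) :
    ∑ x ∈ S ∪ T, dist p x ≤
      (S ∪ T).card * (avgD dist S T * harmonicR (S ∪ T).card) := by
  have hs := card_pos_real hS
  have htri := card_mul_sum_dist_le p S T
  rw [← avgD_mul_card hS hT] at htri
  have hH := add_mul_harmonicR_add_le S.card T.card
  have hM : 0 ≤ avgD dist S T := avgD_nonneg S T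
  rw [Finset.sum_union hd, Finset.card_union_of_disjoint hd]
  push_cast
  generalize avgD dist S T = M at *
  have hp' : ∑ x ∈ S, dist p x ≤ S.card * (M * harmonicR S.card) :=
    hp.trans (mul_le_mul_of_nonneg_left
      (mul_le_mul_of_nonneg_right hm (harmonicR_nonneg _)) hs.le)
  refine le_of_mul_le_mul_left ?_ hs
  have h1 := mul_le_mul_of_nonneg_left hp'
    (by positivity : (0 : ℝ) ≤ (S.card : ℝ) + T.card)
  have h2 := mul_le_mul_of_nonneg_left hH (mul_nonneg hs.le hM)
  linarith

end Metric

/-- `m` is a lower bound for the distances between clusters of `𝒞`, and bounds the average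
distances inside the clusters up to a harmonic factor. -/
structure IsMergeLevel {X : Type*} [MetricSpace X] (𝒞 : Finset (Finset X)) (m : ℝ) : Prop where
  nonneg : 0 ≤ m
  le_avgD : ∀ A ∈ 𝒞, ∀ B ∈ 𝒞, A ≠ B → m ≤ avgD dist A B
  sum_dist_le : ∀ A ∈ 𝒞, ∀ p ∈ A, ∑ x ∈ A, dist p x ≤ A.card * (m * harmonicR A.card)

section Execution

variable {X : Type*} [DecidableEq X]

theorem IsClustering.merge {𝒞 : Finset (Finset X)} {k : ℕ} (h : IsClustering 𝒞 (k + 1))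
    {A B : Finset X} (hA : A ∈ 𝒞) (hB : B ∈ 𝒞) (hAB : A ≠ B) :
    IsClustering (insert (A ∪ B) ((𝒞.erase A).erase B)) k := by
  obtain ⟨hcard, hne, hdis, hcov⟩ := h
  have hdU : ∀ C ∈ (𝒞.erase A).erase B, Disjoint (A ∪ B) C := by
    intro C hC
    simp only [Finset.mem_erase] at hC
    rw [Finset.disjoint_union_left]
    exact ⟨hdis A hA C hC.2.2 (Ne.symm hC.2.1), hdis B hB C hC.2.2 (Ne.symm hC.1)⟩
  have hneU : (A ∪ B).Nonempty := (hne A hA).mono Finset.subset_union_left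
  have hnotin : A ∪ B ∉ (𝒞.erase A).erase B := fun hmem =>
    hneU.ne_empty (Finset.disjoint_self_iff_empty _ |>.1 (hdU _ hmem))
  refine ⟨?_, ?_, ?_, ?_⟩
  · rw [Finset.card_insert_of_notMem hnotin,
      Finset.card_erase_of_mem (Finset.mem_erase.2 ⟨hAB.symm, hB⟩),
      Finset.card_erase_of_mem hA, hcard]
    have : 1 < 𝒞.card := Finset.one_lt_card.2 ⟨A, hA, B, hB, hAB⟩
    omega
  · intro C hC
    rcases Finset.mem_insert.1 hC with rfl | hC
    · exact hneU
    · exact hne C (Finset.mem_of_mem_erase (Finset.mem_of_mem_erase hC))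
  · intro C hC C' hC' hCC
    rcases Finset.mem_insert.1 hC with rfl | hC <;>
      rcases Finset.mem_insert.1 hC' with rfl | hC'
    · exact absurd rfl hCC
    · exact hdU _ hC'
    · exact (hdU _ hC).symm
    · exact hdis C (Finset.mem_of_mem_erase (Finset.mem_of_mem_erase hC)) C'
        (Finset.mem_of_mem_erase (Finset.mem_of_mem_erase hC')) hCC
  · intro x
    obtain ⟨C, hC, hx⟩ := hcov x
    by_cases h1 : C = A
    · exact ⟨A ∪ B, Finset.mem_insert_self _ _, Finset.mem_union_left _ (h1 ▸ hx)⟩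
    by_cases h2 : C = B
    · exact ⟨A ∪ B, Finset.mem_insert_self _ _, Finset.mem_union_right _ (h2 ▸ hx)⟩
    · exact ⟨C, Finset.mem_insert_of_mem
        (Finset.mem_erase.2 ⟨h2, Finset.mem_erase.2 ⟨h1, hC⟩⟩), hx⟩

variable [MetricSpace X]

theorem IsMergeLevel.merge {𝒞 : Finset (Finset X)} {m : ℝ} (h : IsMergeLevel 𝒞 m)
    (hne : ∀ C ∈ 𝒞, C.Nonempty) (hdis : ∀ C ∈ 𝒞, ∀ C' ∈ 𝒞, C ≠ C' → Disjoint C C')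
    {A B : Finset X} (hA : A ∈ 𝒞) (hB : B ∈ 𝒞) (hAB : A ≠ B)
    (hmin : ∀ A' ∈ 𝒞, ∀ B' ∈ 𝒞, A' ≠ B' → avgD dist A B ≤ avgD dist A' B') :
    IsMergeLevel (insert (A ∪ B) ((𝒞.erase A).erase B)) (avgD dist A B) := by
  have hm := h.le_avgD A hA B hB hAB
  have hd := hdis A hA B hB hAB
  have hU : ∀ C ∈ (𝒞.erase A).erase B, avgD dist A B ≤ avgD dist (A ∪ B) C := by
    intro C hC
    simp only [Finset.mem_erase] at hC
    have hCn := hne C hC.2.2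
    have h1 := (le_avgD_iff (hne A hA) hCn _).1 (hmin A hA C hC.2.2 (Ne.symm hC.2.1))
    have h2 := (le_avgD_iff (hne B hB) hCn _).1 (hmin B hB C hC.2.2 (Ne.symm hC.1))
    rw [le_avgD_iff ((hne A hA).mono Finset.subset_union_left) hCn,
      Finset.sum_union hd, Finset.card_union_of_disjoint hd]
    push_cast
    linarith
  refine ⟨avgD_nonneg A B, ?_, ?_⟩
  · intro C hC C' hC' hCC
    rcases Finset.mem_insert.1 hC with rfl | hC <;>
      rcases Finset.mem_insert.1 hC' with rfl | hC'
    · exact absurd rfl hCC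
    · exact hU _ hC'
    · rw [avgD_comm C]
      exact hU _ hC
    · exact hmin C (Finset.mem_of_mem_erase (Finset.mem_of_mem_erase hC)) C'
        (Finset.mem_of_mem_erase (Finset.mem_of_mem_erase hC')) hCC
  · intro C hC p hp
    rcases Finset.mem_insert.1 hC with rfl | hC
    · rcases Finset.mem_union.1 hp with hp | hp
      · exact sum_dist_union_le (hne A hA) (hne B hB) hd hm (h.sum_dist_le A hA p hp)
      · rw [Finset.union_comm, avgD_comm]
        exact sum_dist_union_le (hne B hB) (hne A hA) hd.symm (avgD_comm A B ▸ hm)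
          (h.sum_dist_le B hB p hp)
    · refine (h.sum_dist_le C
        (Finset.mem_of_mem_erase (Finset.mem_of_mem_erase hC)) p hp).trans ?_
      exact mul_le_mul_of_nonneg_left
        (mul_le_mul_of_nonneg_right hm (harmonicR_nonneg _)) (by positivity)

theorem AvgLinkExec.isClustering_and_exists_level [Fintype X] (E : AvgLinkExec X dist) {k : ℕ}
    (hk : 1 ≤ k) (hkn : k ≤ Fintype.card X) :
    IsClustering (E.part k) k ∧ ∃ m, IsMergeLevel (E.part k) m := by
  induction hkn using Nat.decreasingInduction with
  | self =>
    rw [E.init]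
    refine ⟨⟨?_, ?_, ?_, ?_⟩, 0, le_rfl, fun A _ B _ _ => avgD_nonneg A B, ?_⟩
    · rw [Finset.card_image_of_injective _ Finset.singleton_injective, Finset.card_univ]
    · simp
    · simp [eq_comm]
    · simp
    · simp
  | of_succ j hj ih =>
    obtain ⟨hC, m, hm⟩ := ih (by omega)
    obtain ⟨A, hA, B, hB, hAB, hmin, hpart⟩ := E.merge j hk hj
    rw [hpart]
    exact ⟨hC.merge hA hB hAB, _, hm.merge hC.2.1 hC.2.2.1 hA hB hAB hmin⟩

/-- All distances are controlled by the average separation of a clustering with a merge level. -/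
theorem IsMergeLevel.dist_le [Fintype X] {𝒞 : Finset (Finset X)} {m : ℝ} {k : ℕ}
    (h : IsMergeLevel 𝒞 m) (hC : IsClustering 𝒞 k) (hk : 2 ≤ k) (p q : X) :
    dist p q ≤ ((k : ℝ) + 2 * harmonicR (Fintype.card X)) * sepAv dist 𝒞 := by
  obtain ⟨rfl, hne, -, hcov⟩ := hC
  have hk' : (2 : ℝ) ≤ 𝒞.card := by exact_mod_cast hk
  have hms : m ≤ sepAv dist 𝒞 := le_sepAv hk h.le_avgD
  have hs0 : 0 ≤ sepAv dist 𝒞 := h.nonneg.trans hms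
  have hH := harmonicR_nonneg (Fintype.card X)
  have hin : ∀ A ∈ 𝒞, ∀ x ∈ A, ∑ y ∈ A, dist x y ≤
      A.card * (harmonicR (Fintype.card X) * sepAv dist 𝒞) := by
    intro A hA x hx
    refine (h.sum_dist_le A hA x hx).trans (mul_le_mul_of_nonneg_left ?_ (by positivity))
    rw [mul_comm]
    exact mul_le_mul (harmonicR_mono (Finset.card_le_univ A)) hms h.nonneg hH
  obtain ⟨A, hA, hpA⟩ := hcov p
  obtain ⟨B, hB, hqB⟩ := hcov q
  have hp := hin A hA p hpA
  have hq := hin B hB q hqB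
  have hApos := card_pos_real (hne A hA)
  have hBpos := card_pos_real (hne B hB)
  by_cases hAB : A = B
  · subst hAB
    have h1 := card_mul_dist_le p q A
    have h2 : dist p q ≤ 2 * (harmonicR (Fintype.card X) * sepAv dist 𝒞) :=
      le_of_mul_le_mul_left (by linarith) hApos
    have h3 : 0 ≤ (𝒞.card : ℝ) * sepAv dist 𝒞 := by positivity
    linarith
  · have h1 := card_mul_sum_dist_le p A B
    have h2 := card_mul_dist_le p q B
    have h3 := avgD_le_mul_sepAv hk hne hA hB hAB
    rw [← avgD_mul_card (hne A hA) (hne B hB)] at h1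
    have h4 : dist p q ≤ 2 * (harmonicR (Fintype.card X) * sepAv dist 𝒞) + avgD dist A B := by
      refine le_of_mul_le_mul_left ?_ (mul_pos hApos hBpos)
      have h5 := mul_le_mul_of_nonneg_left h2 hApos.le
      have h6 := mul_le_mul_of_nonneg_left hp hBpos.le
      have h7 := mul_le_mul_of_nonneg_left hq hApos.le
      linarith
    linarith

end Execution

/-- Separability guarantee of average-link: for every `2 ≤ k ≤ n` and every execution of
average-link on a finite metric space with `n` points,
`sep_av(A^k) ≥ OPT_SEP(k) / (k + 2·H_n)`. -/
theorem avgLink_sepAv_guarantee {X : Type*} [MetricSpace X] [Fintype X] [DecidableEq X]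
    (E : AvgLinkExec X dist) (k : ℕ) (hk2 : 2 ≤ k) (hkn : k ≤ Fintype.card X) :
    sSup {r : ℝ | ∃ 𝒞 : Finset (Finset X), IsClustering 𝒞 k ∧ r = sepAv dist 𝒞}
        / ((k : ℝ) + 2 * harmonicR (Fintype.card X))
      ≤ sepAv dist (E.part k) := by
  obtain ⟨hC, m, hm⟩ := E.isClustering_and_exists_level (by omega) hkn
  have hH := harmonicR_nonneg (Fintype.card X)
  have hk : (2 : ℝ) ≤ k := by exact_mod_cast hk2
  have hs0 : 0 ≤ sepAv dist (E.part k) :=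
    hm.nonneg.trans (le_sepAv (hC.1.symm ▸ hk2) hm.le_avgD)
  have hD : 0 ≤ ((k : ℝ) + 2 * harmonicR (Fintype.card X)) * sepAv dist (E.part k) := by
    positivity
  rw [div_le_iff₀ (by linarith), mul_comm]
  refine Real.sSup_le ?_ hD
  rintro r ⟨𝒞, h𝒞, rfl⟩
  exact sepAv_le (h𝒞.1.symm ▸ hk2) fun C _ C' _ _ =>
    avgD_le_of_dist_le hD (hm.dist_le hC hk2)
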